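/- arXiv:2203.13225 — 3 statements merged into one kernel-verified Lean document; each statement's English description precedes it below -/
import Mathlib

section
/- There exist absolute constants c₁, c₂, C₁, C₂, C₃ > 0 such that the following holds. Assume each ℓ_j is convex and G-Lipschitz, let λ > 0 and r > 0 satisfy λ ≤ c₁ G/r and r ≤ c₂ ε'/G, and restrict 𝓛_sm^{ε,λ} and Γ_{ε,λ} to B_r(x̄) ∩ 𝒳 (the Euclidean ball of radius r about x̄ intersected with 𝒳). Then: (i) the two restricted functions have the same (unique) minimizer x⋆; (ii) Γ_{ε,λ} is C₁λ-strongly convex on B_r(x̄) ∩ 𝒳; (iii) each γ_i is C₂G-Lipschitz on B_r(x̄) ∩ 𝒳; and (iv) for every x ∈ B_r(x̄) ∩ 𝒳, 𝓛_sm^{ε,λ}(x) − 𝓛_sm^{ε,λ}(x⋆) ≤ C₃ (Γ_{ε,λ}(x) − Γ_{ε,λ}(x⋆)). -/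
open Real

lemma aux_norm {E : Type*} [NormedAddCommGroup E] [InnerProductSpace ℝ E] (x y c : E) (a b : ℝ)
    (hab : a + b = 1) :
    ‖a • x + b • y - c‖ ^ 2 = a * ‖x - c‖ ^ 2 + b * ‖y - c‖ ^ 2 - a * b * ‖x - y‖ ^ 2 := by
  have h1 : a • x + b • y - c = a • (x - c) + b • (y - c) := by
    have : c = (a + b) • c := by rw [hab, one_smul]
    nth_rw 1 [this]
    module
  have h2 : x - y = (x - c) - (y - c) := by abel
  rw [h1, h2, norm_add_sq_real, norm_sub_sq_real (x - c) (y - c), norm_smul, norm_smul, inner_smul_left,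
    inner_smul_right, mul_pow, mul_pow]
  simp only [Real.norm_eq_abs, sq_abs, conj_trivial]
  obtain rfl : b = 1 - a := by linarith
  ring

lemma aux_core {E : Type*} [NormedAddCommGroup E] [InnerProductSpace ℝ E] [ProperSpace E]
    (M : ℕ) (𝒳 : Set E) (hX : Convex ℝ 𝒳) (hXc : IsClosed 𝒳)
    (L : Fin M → E → ℝ) (hM : 2 ≤ M)
    (G ε' lam r : ℝ) (hG : 0 < G) (he : 0 < ε') (hlam : 0 < lam) (hr : 0 < r)
    (hconv : ∀ i, ConvexOn ℝ 𝒳 (L i))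
    (hlip : ∀ i, ∀ z ∈ 𝒳, ∀ z' ∈ 𝒳, |L i z - L i z'| ≤ G * ‖z - z'‖)
    (hlr : lam * r ≤ G) (hGr : G * r ≤ ε') (xbar : E) (hxb : xbar ∈ 𝒳) :
      let S : Set E := Metric.closedBall xbar r ∩ 𝒳
      let Lsm : E → ℝ := fun z =>
        ε' * Real.log (∑ i, Real.exp (L i z / ε')) + lam / 2 * ‖z - xbar‖ ^ 2
      let pbar : Fin M → ℝ := fun i =>
        Real.exp (L i xbar / ε') / ∑ k, Real.exp (L k xbar / ε')
      let γ : Fin M → E → ℝ := fun i z =>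
        ε' * Real.exp ((L i z - L i xbar + lam / 2 * ‖z - xbar‖ ^ 2) / ε')
      let Γ : E → ℝ := fun z => ∑ i, pbar i * γ i z
      (∃ xs ∈ S, IsMinOn Lsm S xs ∧ IsMinOn Γ S xs ∧
        (∀ z ∈ S, IsMinOn Lsm S z → z = xs) ∧ (∀ z ∈ S, IsMinOn Γ S z → z = xs)) ∧
      StrongConvexOn S (exp (-1) * lam) Γ ∧
      (∀ i, ∀ z ∈ S, ∀ z' ∈ S, |γ i z - γ i z'| ≤ 2 * exp 2 * G * ‖z - z'‖) ∧
      (∀ xs ∈ S, IsMinOn Γ S xs → ∀ z ∈ S, Lsm z - Lsm xs ≤ exp 1 * (Γ z - Γ xs)) := by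
  intro S Lsm pbar γ Γ
  have hne : Nonempty (Fin M) := ⟨⟨0, by omega⟩⟩
  have hZ : ∀ z, 0 < ∑ i, Real.exp (L i z / ε') := fun z =>
    Finset.sum_pos (fun i _ => exp_pos _) Finset.univ_nonempty
  have hp0 : ∀ i, 0 ≤ pbar i := fun i => div_nonneg (exp_pos _).le (hZ xbar).le
  have hp1 : ∑ i, pbar i = 1 := by
    simp only [pbar]
    rw [← Finset.sum_div, div_self (hZ xbar).ne']
  have hSr : ∀ z ∈ S, ‖z - xbar‖ ≤ r := fun z hz => by
    simpa [dist_eq_norm] using hz.1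
  have hSc : Convex ℝ S := (convex_closedBall xbar r).inter hX
  have hScomp : IsCompact S := (isCompact_closedBall xbar r).inter_right hXc
  have hxS : xbar ∈ S := ⟨Metric.mem_closedBall_self hr.le, hxb⟩
  let h : Fin M → E → ℝ := fun i z => (L i z - L i xbar + lam / 2 * ‖z - xbar‖ ^ 2) / ε'
  have hγ : ∀ i z, γ i z = ε' * exp (h i z) := fun i z => rfl
  have hlo : ∀ i, ∀ z ∈ S, -1 ≤ h i z := by
    intro i z hz
    have h1 := (abs_le.1 (hlip i z hz.2 xbar hxb)).1
    have h2 := mul_le_mul_of_nonneg_left (hSr z hz) hG.le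
    simp only [h]
    rw [le_div_iff₀ he]
    have : 0 ≤ lam / 2 * ‖z - xbar‖ ^ 2 := by positivity
    linarith
  have hhi : ∀ i, ∀ z ∈ S, h i z ≤ 2 := by
    intro i z hz
    have h1 := (abs_le.1 (hlip i z hz.2 xbar hxb)).2
    have h2 := mul_le_mul_of_nonneg_left (hSr z hz) hG.le
    simp only [h]
    rw [div_le_iff₀ he]
    have h3 : ‖z - xbar‖ ^ 2 ≤ r ^ 2 := pow_le_pow_left₀ (norm_nonneg _) (hSr z hz) 2
    have h4 := mul_le_mul_of_nonneg_left h3 (by positivity : 0 ≤ lam / 2)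
    have h5 := mul_le_mul_of_nonneg_right hlr hr.le
    nlinarith
  have hhL : ∀ i, ∀ z ∈ S, ∀ z' ∈ S, ε' * (h i z - h i z') ≤ 2 * G * ‖z - z'‖ := by
    intro i z hz z' hz'
    have h1 := (abs_le.1 (hlip i z hz.2 z' hz'.2)).2
    have e : ε' * (h i z - h i z') =
        L i z - L i z' + lam / 2 * (‖z - xbar‖ ^ 2 - ‖z' - xbar‖ ^ 2) := by
      simp only [h]; field_simp; ring
    rw [e]
    have h2 : ‖z - xbar‖ - ‖z' - xbar‖ ≤ ‖z - z'‖ := by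
      have := norm_sub_norm_le (z - xbar) (z' - xbar)
      simpa using this
    have h3 : ‖z - xbar‖ ^ 2 - ‖z' - xbar‖ ^ 2 ≤ 2 * r * ‖z - z'‖ := by
      have a1 := hSr z hz
      have a2 := hSr z' hz'
      have a3 := norm_nonneg (z - xbar)
      have a4 := norm_nonneg (z' - xbar)
      calc ‖z - xbar‖ ^ 2 - ‖z' - xbar‖ ^ 2
          = (‖z - xbar‖ + ‖z' - xbar‖) * (‖z - xbar‖ - ‖z' - xbar‖) := by ring
        _ ≤ (‖z - xbar‖ + ‖z' - xbar‖) * ‖z - z'‖ := by gcongr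
        _ ≤ 2 * r * ‖z - z'‖ := by gcongr; linarith
    have h4 := mul_le_mul_of_nonneg_left h3 (by positivity : 0 ≤ lam / 2)
    have h5 := mul_le_mul_of_nonneg_right hlr (norm_nonneg (z - z'))
    linarith
  -- one-sided Lipschitz
  have hg1 : ∀ i, ∀ z ∈ S, ∀ z' ∈ S, γ i z - γ i z' ≤ 2 * exp 2 * G * ‖z - z'‖ := by
    intro i z hz z' hz'
    rw [hγ, hγ]
    have h1 : exp (h i z) - exp (h i z') ≤ exp (h i z) * (h i z - h i z') := by
      have := add_one_le_exp (h i z' - h i z)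
      have h2 : exp (h i z') = exp (h i z) * exp (h i z' - h i z) := by
        rw [← exp_add]; congr 1; ring
      rw [h2]
      nlinarith [exp_pos (h i z)]
    calc ε' * exp (h i z) - ε' * exp (h i z') = ε' * (exp (h i z) - exp (h i z')) := by ring
      _ ≤ ε' * (exp (h i z) * (h i z - h i z')) := by gcongr
      _ = exp (h i z) * (ε' * (h i z - h i z')) := by ring
      _ ≤ exp (h i z) * (2 * G * ‖z - z'‖) := mul_le_mul_of_nonneg_left (hhL i z hz z' hz') (exp_pos _).le
      _ ≤ exp 2 * (2 * G * ‖z - z'‖) := by gcongr; exact hhi i z hz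
      _ = _ := by ring
  have hg : ∀ i, ∀ z ∈ S, ∀ z' ∈ S, |γ i z - γ i z'| ≤ 2 * exp 2 * G * ‖z - z'‖ := by
    intro i z hz z' hz'
    rw [abs_le]
    have := hg1 i z' hz' z hz
    rw [norm_sub_rev] at this
    exact ⟨by linarith, hg1 i z hz z' hz'⟩
  have hstrong : StrongConvexOn S (exp (-1) * lam) Γ := by
    refine ⟨hSc, ?_⟩
    intro x hx y hy a b ha hb hab
    have key : ∀ i, γ i (a • x + b • y) ≤ a * γ i x + b * γ i y
        - a * b * (exp (-1) * lam / 2 * ‖x - y‖ ^ 2) := by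
      intro i
      have hm : a • x + b • y ∈ S := hSc hx hy ha hb hab
      have h1 := (hconv i).2 hx.2 hy.2 ha hb hab
      simp only [smul_eq_mul] at h1
      have h2 := aux_norm x y xbar a b hab
      set t := a * b * (lam / 2 * ‖x - y‖ ^ 2) / ε' with ht
      have ht0 : 0 ≤ t := by positivity
      have h3 : h i (a • x + b • y) + t ≤ a * h i x + b * h i y := by
        have e1 : a * h i x + b * h i y - t = (a * L i x + b * L i y - L i xbar
            + lam / 2 * ‖a • x + b • y - xbar‖ ^ 2) / ε' := by
          rw [h2]
          simp only [h, ht]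
          obtain rfl : b = 1 - a := by linarith
          field_simp
          ring
        have : h i (a • x + b • y) ≤ a * h i x + b * h i y - t := by
          rw [e1]
          simp only [h]
          gcongr
        linarith
      have h4 : exp (a * h i x + b * h i y) ≤ a * exp (h i x) + b * exp (h i y) := by
        have := convexOn_exp.2 (Set.mem_univ (h i x)) (Set.mem_univ (h i y)) ha hb hab
        simpa using this
      have h5 : exp (h i (a • x + b • y)) * (t + 1) ≤ exp (a * h i x + b * h i y) := by
        calc _ ≤ exp (h i (a • x + b • y)) * exp t := by gcongr; exact add_one_le_exp t
          _ = exp (h i (a • x + b • y) + t) := (exp_add _ _).symm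
          _ ≤ _ := exp_le_exp.2 h3
      have h6 : exp (-1) * t ≤ exp (h i (a • x + b • y)) * t := by
        gcongr
        exact hlo i _ hm
      have h7 : exp (h i (a • x + b • y)) ≤ a * exp (h i x) + b * exp (h i y) - exp (-1) * t := by
        linarith
      rw [hγ, hγ, hγ]
      have h8 := mul_le_mul_of_nonneg_left h7 he.le
      have h9 : ε' * t = a * b * (lam / 2 * ‖x - y‖ ^ 2) := by
        rw [ht]; field_simp
      calc _ ≤ _ := h8
        _ = a * (ε' * exp (h i x)) + b * (ε' * exp (h i y)) - exp (-1) * (ε' * t) := by ring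
        _ = _ := by rw [h9]; ring
    calc Γ (a • x + b • y) ≤ ∑ i, pbar i * (a * γ i x + b * γ i y
        - a * b * (exp (-1) * lam / 2 * ‖x - y‖ ^ 2)) :=
          Finset.sum_le_sum fun i _ => mul_le_mul_of_nonneg_left (key i) (hp0 i)
      _ = a * Γ x + b * Γ y - (∑ i, pbar i) * (a * b * (exp (-1) * lam / 2 * ‖x - y‖ ^ 2)) := by
          simp only [Γ, Finset.mul_sum, Finset.sum_mul]
          rw [← Finset.sum_add_distrib, ← Finset.sum_sub_distrib]
          exact Finset.sum_congr rfl fun i _ => by ring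
      _ = _ := by rw [hp1, one_mul]; rfl
  -- relation
  let A : ℝ := ε' * Real.log (∑ i, Real.exp (L i xbar / ε'))
  have hrel : ∀ z, Γ z = ε' * exp ((Lsm z - A) / ε') := by
    intro z
    have e1 : (Lsm z - A) / ε' = Real.log (∑ i, Real.exp (L i z / ε'))
        - Real.log (∑ i, Real.exp (L i xbar / ε')) + lam / 2 * ‖z - xbar‖ ^ 2 / ε' := by
      simp only [Lsm, A]; field_simp; ring
    rw [e1, exp_add, exp_sub, exp_log (hZ z), exp_log (hZ xbar)]
    simp only [Γ, pbar, γ]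
    rw [Finset.sum_div, Finset.sum_mul, Finset.mul_sum]
    refine Finset.sum_congr rfl fun i _ => ?_
    have e2 : (L i z - L i xbar + lam / 2 * ‖z - xbar‖ ^ 2) / ε'
      = L i z / ε' - L i xbar / ε' + lam / 2 * ‖z - xbar‖ ^ 2 / ε' := by ring
    rw [e2, exp_add, exp_sub]
    have := (exp_pos (L i xbar / ε')).ne'
    have := (hZ xbar).ne'
    field_simp
  have hmono : ∀ z z', Γ z ≤ Γ z' ↔ Lsm z ≤ Lsm z' := by
    intro z z'
    rw [hrel, hrel, mul_le_mul_iff_right₀ he, exp_le_exp, div_le_div_iff_of_pos_right he]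
    constructor <;> intro h <;> linarith
  have hmin : ∀ z, IsMinOn Γ S z ↔ IsMinOn Lsm S z := by
    intro z
    simp only [isMinOn_iff, hmono]
  have hΓlo : ∀ z ∈ S, ε' * exp (-1) ≤ Γ z := by
    intro z hz
    calc ε' * exp (-1) = ∑ i, pbar i * (ε' * exp (-1)) := by rw [← Finset.sum_mul, hp1, one_mul]
      _ ≤ _ := Finset.sum_le_sum fun i _ => mul_le_mul_of_nonneg_left
          (by rw [hγ]; gcongr; exact hlo i z hz) (hp0 i)
  have hcont : ContinuousOn Γ S := by
    refine continuousOn_finsetSum _ fun i _ => continuousOn_const.mul ?_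
    have : LipschitzOnWith (Real.toNNReal (2 * exp 2 * G)) (γ i) S := by
      refine LipschitzOnWith.of_dist_le_mul fun z hz z' hz' => ?_
      rw [Real.dist_eq, dist_eq_norm, Real.coe_toNNReal _ (by positivity)]
      exact hg i z hz z' hz'
    exact this.continuousOn
  have hstrict : StrictConvexOn ℝ S Γ := hstrong.strictConvexOn (by positivity)
  obtain ⟨xs, hxs, hxm⟩ := hScomp.exists_isMinOn ⟨xbar, hxS⟩ hcont
  refine ⟨⟨xs, hxs, (hmin _).1 hxm, hxm, ?_, ?_⟩, hstrong, hg, ?_⟩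
  · exact fun z hz hzm => hstrict.eq_of_isMinOn ((hmin _).2 hzm) hxm hz hxs
  · exact fun z hz hzm => hstrict.eq_of_isMinOn hzm hxm hz hxs
  · intro x hx hxm z hz
    have h1 := (isMinOn_iff.1 ((hmin _).1 hxm)) z hz
    have h2 := hΓlo x hx
    have h3 : Γ z = Γ x * exp ((Lsm z - Lsm x) / ε') := by
      rw [hrel, hrel, mul_assoc, ← exp_add]; congr 2; ring
    have h4 := add_one_le_exp ((Lsm z - Lsm x) / ε')
    have h5 : 0 ≤ (Lsm z - Lsm x) / ε' := div_nonneg (by linarith) he.le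
    have h6 : exp (-1) * (Lsm z - Lsm x) ≤ Γ z - Γ x := by
      calc exp (-1) * (Lsm z - Lsm x) = ε' * exp (-1) * ((Lsm z - Lsm x) / ε') := by field_simp
        _ ≤ Γ x * ((Lsm z - Lsm x) / ε') := by gcongr
        _ ≤ Γ x * (exp ((Lsm z - Lsm x) / ε') - 1) := by
            have : 0 ≤ Γ x := le_trans (by positivity) h2
            gcongr; linarith
        _ = _ := by rw [h3]; ring
    calc Lsm z - Lsm x = exp 1 * (exp (-1) * (Lsm z - Lsm x)) := by
          rw [← mul_assoc, ← exp_add]; simp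
      _ ≤ _ := by gcongr

/-- There are absolute constants `c₁, c₂, C₁, C₂, C₃ > 0` such that for
convex `G`-Lipschitz losses, `λ ≤ c₁ G/r` and `r ≤ c₂ ε'/G`, the regularized group-softmax
`𝓛_sm^{ε,λ}` and the regularized exponentiated group-softmax `Γ_{ε,λ}` restricted to
`B_r(xbar) ∩ 𝒳` have the same unique minimizer `x⋆`, `Γ_{ε,λ}` is `C₁λ`-strongly convex, each
`γ_i` is `C₂ G`-Lipschitz, and `𝓛_sm^{ε,λ}(x) − 𝓛_sm^{ε,λ}(x⋆) ≤ C₃ (Γ_{ε,λ}(x) − Γ_{ε,λ}(x⋆))`. -/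
theorem stmt1 :
    ∃ c₁ c₂ C₁ C₂ C₃ : ℝ, 0 < c₁ ∧ 0 < c₂ ∧ 0 < C₁ ∧ 0 < C₂ ∧ 0 < C₃ ∧
    ∀ (d N M : ℕ) (_ : 2 ≤ M)
      (𝒳 : Set (EuclideanSpace ℝ (Fin d))) (_ : Convex ℝ 𝒳) (_ : IsClosed 𝒳)
      (ℓ : Fin N → EuclideanSpace ℝ (Fin d) → ℝ)
      (w : Fin M → Fin N → ℝ) (_ : ∀ i, w i ∈ stdSimplex ℝ (Fin N))
      (G ε ε' lam r : ℝ) (_ : 0 < G) (_ : 0 < ε)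
      (_ : ε' = ε / (2 * Real.log (M : ℝ)))
      (_ : 0 < lam) (_ : 0 < r)
      (_ : ∀ j, ConvexOn ℝ 𝒳 (ℓ j))
      (_ : ∀ j, ∀ z ∈ 𝒳, ∀ z' ∈ 𝒳, |ℓ j z - ℓ j z'| ≤ G * ‖z - z'‖)
      (_ : lam ≤ c₁ * G / r) (_ : r ≤ c₂ * ε' / G)
      (xbar : EuclideanSpace ℝ (Fin d)) (_ : xbar ∈ 𝒳),
      let L : Fin M → EuclideanSpace ℝ (Fin d) → ℝ := fun i z => ∑ j, w i j * ℓ j z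
      let S : Set (EuclideanSpace ℝ (Fin d)) := Metric.closedBall xbar r ∩ 𝒳
      let Lsm : EuclideanSpace ℝ (Fin d) → ℝ := fun z =>
        ε' * Real.log (∑ i, Real.exp (L i z / ε')) + lam / 2 * ‖z - xbar‖ ^ 2
      let pbar : Fin M → ℝ := fun i =>
        Real.exp (L i xbar / ε') / ∑ k, Real.exp (L k xbar / ε')
      let γ : Fin M → EuclideanSpace ℝ (Fin d) → ℝ := fun i z =>
        ε' * Real.exp ((L i z - L i xbar + lam / 2 * ‖z - xbar‖ ^ 2) / ε')
      let Γ : EuclideanSpace ℝ (Fin d) → ℝ := fun z => ∑ i, pbar i * γ i z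
      (∃ xs ∈ S, IsMinOn Lsm S xs ∧ IsMinOn Γ S xs ∧
        (∀ z ∈ S, IsMinOn Lsm S z → z = xs) ∧ (∀ z ∈ S, IsMinOn Γ S z → z = xs)) ∧
      StrongConvexOn S (C₁ * lam) Γ ∧
      (∀ i, ∀ z ∈ S, ∀ z' ∈ S, |γ i z - γ i z'| ≤ C₂ * G * ‖z - z'‖) ∧
      (∀ xs ∈ S, IsMinOn Γ S xs → ∀ z ∈ S, Lsm z - Lsm xs ≤ C₃ * (Γ z - Γ xs)) := by
  refine ⟨1, 1, exp (-1), 2 * exp 2, exp 1, one_pos, one_pos, exp_pos _, by positivity, exp_pos _, ?_⟩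
  intro d N M hM 𝒳 hX hXc ℓ w hw G ε ε' lam r hG hε hε' hlam hr hconv hlip hlr hGr xbar hxb
  have he : 0 < ε' := by
    rw [hε']
    have : 0 < Real.log (M : ℝ) := Real.log_pos (by exact_mod_cast hM)
    positivity
  rw [one_mul, le_div_iff₀ hr] at hlr
  rw [one_mul, le_div_iff₀ hG] at hGr
  refine aux_core M 𝒳 hX hXc (fun i z => ∑ j, w i j * ℓ j z) hM G ε' lam r hG he hlam hr ?_ ?_ hlr
    (by linarith) xbar hxb
  · intro i
    refine ⟨hX, fun x hx y hy a b ha hb hab => ?_⟩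
    simp only [smul_eq_mul, Finset.mul_sum]
    rw [← Finset.sum_add_distrib]
    refine Finset.sum_le_sum fun j _ => ?_
    have := mul_le_mul_of_nonneg_left ((hconv j).2 hx hy ha hb hab) ((hw i).1 j)
    simp only [smul_eq_mul] at this
    linarith
  · intro i z hz z' hz'
    rw [← Finset.sum_sub_distrib]
    calc _ ≤ ∑ j, |w i j * ℓ j z - w i j * ℓ j z'| := Finset.abs_sum_le_sum_abs _ _
      _ ≤ ∑ j, w i j * (G * ‖z - z'‖) := Finset.sum_le_sum fun j _ => by
          rw [← mul_sub, abs_mul, abs_of_nonneg ((hw i).1 j)]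
          exact mul_le_mul_of_nonneg_left (hlip j z hz z' hz') ((hw i).1 j)
      _ = _ := by rw [← Finset.sum_mul, (hw i).2, one_mul]
end

section
/- Assume each ℓ_j is convex and G-Lipschitz, let 0 < r ≤ ε'/G, 0 < λ ≤ G/r, x̄ ∈ 𝒳, i ∈ [M] and x ∈ B_r(x̄) ∩ 𝒳. Then the MLMC estimator is unbiased, E[M̂[γ_i(x)]] = γ_i(x), and there is an absolute constant C such that E[(M̂[γ_i(x)])²] ≤ C (G⁴‖x − x̄‖⁴/ε'² + ε'²). Moreover E[2^J] is finite and bounded by an absolute constant, so the expected number of loss evaluations used by the estimator is O(1). -/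
open Real

noncomputable section

/-- Group loss `𝓛_i(x) = Σ_j w_{ij} ℓ_j(x)`. -/
def groupLoss {d N M : ℕ} (w : Fin M → Fin N → ℝ)
    (ℓ : Fin N → EuclideanSpace ℝ (Fin d) → ℝ) (i : Fin M)
    (x : EuclideanSpace ℝ (Fin d)) : ℝ :=
  ∑ j, w i j * ℓ j x

/-- `γ̂(x,x'; s₁,…,sₙ) = ε' e^{((1/n)Σ_k (ℓ_{s_k}(x) − ℓ_{s_k}(x')) + (λ/2)‖x−x̄‖²)/ε'}`,
evaluated on the first `n` terms of the sample sequence `s`. -/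
def gammaHat {d N : ℕ} (ℓ : Fin N → EuclideanSpace ℝ (Fin d) → ℝ) (ε' lam : ℝ)
    (xbar x x' : EuclideanSpace ℝ (Fin d)) (n : ℕ) (s : ℕ → Fin N) : ℝ :=
  ε' * Real.exp (((n : ℝ)⁻¹ * ∑ k ∈ Finset.range n, (ℓ (s k) x - ℓ (s k) x') +
      lam / 2 * ‖x - xbar‖ ^ 2) / ε')

/-- `D̂_{2m} = γ̂(x,x'; s₁,…,s_{2m}) − ½(γ̂(x,x'; s₁,…,s_m) + γ̂(x,x'; s_{m+1},…,s_{2m}))`. -/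
def dHat {d N : ℕ} (ℓ : Fin N → EuclideanSpace ℝ (Fin d) → ℝ) (ε' lam : ℝ)
    (xbar x x' : EuclideanSpace ℝ (Fin d)) (m : ℕ) (s : ℕ → Fin N) : ℝ :=
  gammaHat ℓ ε' lam xbar x x' (2 * m) s -
    (gammaHat ℓ ε' lam xbar x x' m s + gammaHat ℓ ε' lam xbar x x' m (fun k => s (m + k))) / 2

/-- `p_j = (1 − 8^{−1/2}) 8^{−j/2}`, the law of the MLMC level `J`. -/
def geomP (j : ℕ) : ℝ := (1 - (Real.sqrt 8)⁻¹) * ((Real.sqrt 8)⁻¹) ^ j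

/-- The MLMC estimator value at level `j` with sample sequence `s`:
`M̂ = γ̂(x,x'; S₁) + D̂_{2^j}/p_j`, with `D̂_1 = 0`. -/
def mlmcVal {d N : ℕ} (ℓ : Fin N → EuclideanSpace ℝ (Fin d) → ℝ) (ε' lam : ℝ)
    (xbar x x' : EuclideanSpace ℝ (Fin d)) (j : ℕ) (s : ℕ → Fin N) : ℝ :=
  gammaHat ℓ ε' lam xbar x x' 1 s +
    (if j = 0 then 0 else dHat ℓ ε' lam xbar x x' (2 ^ (j - 1)) s) / geomP j

/-- Extends a finite sample tuple to an infinite sequence (values past `n` are irrelevant). -/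
def extSeq {N n : ℕ} (hn : 0 < n) (s : Fin n → Fin N) : ℕ → Fin N :=
  fun k => if h : k < n then s ⟨k, h⟩ else s ⟨0, hn⟩

/-- The `j`-th term of the expectation of `f(J, S₁, S₂, …)` where `J` has law `geomP` and
`S₁, S₂, …` are i.i.d. with law `w_i`: `p_j · E_{S ~ w_i^{⊗2^j}}[f(j, S)]`. -/
def mlmcSummand {N M : ℕ} (w : Fin M → Fin N → ℝ) (i : Fin M)
    (ℱ : ℕ → (ℕ → Fin N) → ℝ) (j : ℕ) : ℝ :=
  geomP j * ∑ s : Fin (2 ^ j) → Fin N,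
    (∏ k, w i (s k)) * ℱ j (extSeq (Nat.two_pow_pos j) s)

/-- Expectation of `f(J, S₁, S₂, …)`, `J ~ geomP`, `S₁, S₂, … ~ w_i` i.i.d. independent of `J`. -/
def mlmcExp {N M : ℕ} (w : Fin M → Fin N → ℝ) (i : Fin M)
    (ℱ : ℕ → (ℕ → Fin N) → ℝ) : ℝ :=
  ∑' j : ℕ, mlmcSummand w i ℱ j

section Helpers

def AA {N : ℕ} (v z : Fin N → ℝ) (t : ℝ) : ℝ := ∑ j, v j * Real.exp (t * z j)

def PP {N : ℕ} (v : Fin N → ℝ) (n : ℕ) (hn : 0 < n) (F : (ℕ → Fin N) → ℝ) : ℝ :=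
  ∑ s : Fin n → Fin N, (∏ k, v (s k)) * F (extSeq hn s)

theorem PP_exp {N : ℕ} (v z : Fin N → ℝ) (n : ℕ) (hn : 0 < n) (c : ℕ → ℝ) :
    PP v n hn (fun s => Real.exp (∑ k ∈ Finset.range n, c k * z (s k))) =
      ∏ k ∈ Finset.range n, AA v z (c k) := by
  unfold PP AA
  rw [← Fin.prod_univ_eq_prod_range (fun k => ∑ j, v j * Real.exp (c k * z j)) n,
    Finset.prod_univ_sum, Fintype.piFinset_univ]
  refine Finset.sum_congr rfl fun s _ => ?_
  beta_reduce
  rw [Finset.prod_mul_distrib, Real.exp_sum,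
    ← Fin.prod_univ_eq_prod_range (fun k => Real.exp (c k * z (extSeq hn s k))) n]
  congr 1
  refine Finset.prod_congr rfl fun k _ => ?_
  simp [extSeq]

theorem PP_mono {N : ℕ} {v : Fin N → ℝ} (hv : ∀ j, 0 ≤ v j) {n : ℕ} {hn : 0 < n}
    {F H : (ℕ → Fin N) → ℝ} (h : ∀ s, F s ≤ H s) : PP v n hn F ≤ PP v n hn H := by
  unfold PP
  exact Finset.sum_le_sum fun s _ =>
    mul_le_mul_of_nonneg_left (h _) (Finset.prod_nonneg fun _ _ => hv _)

theorem PP_add {N : ℕ} (v : Fin N → ℝ) (n : ℕ) (hn : 0 < n) (F H : (ℕ → Fin N) → ℝ) :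
    PP v n hn (fun s => F s + H s) = PP v n hn F + PP v n hn H := by
  simp [PP, mul_add, Finset.sum_add_distrib]

theorem PP_mul {N : ℕ} (v : Fin N → ℝ) (n : ℕ) (hn : 0 < n) (a : ℝ) (F : (ℕ → Fin N) → ℝ) :
    PP v n hn (fun s => a * F s) = a * PP v n hn F := by
  simp only [PP, Finset.mul_sum]
  refine Finset.sum_congr rfl fun s _ => by ring

theorem AA_zero {N : ℕ} {v z : Fin N → ℝ} (hv : ∑ j, v j = 1) : AA v z 0 = 1 := by
  simp [AA, hv]

theorem PP_one {N : ℕ} {v : Fin N → ℝ} (hv : ∑ j, v j = 1) (n : ℕ) (hn : 0 < n) :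
    PP v n hn (fun _ => 1) = 1 := by
  have := PP_exp v (fun _ => 0) n hn (fun _ => 0)
  simpa [AA_zero hv] using this

theorem PP_const {N : ℕ} {v : Fin N → ℝ} (hv : ∑ j, v j = 1) (n : ℕ) (hn : 0 < n) (a : ℝ) :
    PP v n hn (fun _ => a) = a := by
  have := PP_mul v n hn a (fun _ => 1)
  simpa [PP_one hv] using this

theorem PP_block {N : ℕ} {v z : Fin N → ℝ} (hv : ∑ j, v j = 1) (n : ℕ) (hn : 0 < n)
    (a m b : ℕ) (h : n = a + m + b) (t : ℝ) :
    PP v n hn (fun s => Real.exp (t * ∑ k ∈ Finset.range m, z (s (a + k)))) =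
      AA v z t ^ m := by
  have key := PP_exp v z n hn (fun k => if k < a then 0 else if k < a + m then t else 0)
  subst h
  simp only [Finset.sum_range_add, Finset.prod_range_add] at key
  have e1 : ∏ k ∈ Finset.range a, AA v z (if k < a then 0 else if k < a + m then t else 0) = 1 := by
    refine Finset.prod_eq_one fun k hk => ?_
    rw [if_pos (Finset.mem_range.1 hk), AA_zero hv]
  have e2 : ∏ k ∈ Finset.range m,
      AA v z (if a + k < a then 0 else if a + k < a + m then t else 0) = AA v z t ^ m := by
    rw [Finset.prod_congr rfl (g := fun _ => AA v z t), Finset.prod_const, Finset.card_range]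
    intro k hk
    have := Finset.mem_range.1 hk
    rw [if_neg (by omega), if_pos (by omega)]
  have e3 : ∏ k ∈ Finset.range b,
      AA v z (if a + m + k < a then 0 else if a + m + k < a + m then t else 0) = 1 := by
    refine Finset.prod_eq_one fun k hk => ?_
    rw [if_neg (by omega), if_neg (by omega), AA_zero hv]
  rw [e1, e2, e3, one_mul, mul_one] at key
  rw [← key]
  congr 1
  funext s
  congr 1
  have f1 : ∑ k ∈ Finset.range a, (if k < a then 0 else if k < a + m then t else 0) * z (s k)
      = 0 := by
    refine Finset.sum_eq_zero fun k hk => ?_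
    rw [if_pos (Finset.mem_range.1 hk), zero_mul]
  have f2 : ∑ k ∈ Finset.range m, (if a + k < a then 0 else if a + k < a + m then t else 0) *
      z (s (a + k)) = t * ∑ k ∈ Finset.range m, z (s (a + k)) := by
    rw [Finset.mul_sum]
    refine Finset.sum_congr rfl fun k hk => ?_
    have := Finset.mem_range.1 hk
    rw [if_neg (by omega), if_pos (by omega)]
  have f3 : ∑ k ∈ Finset.range b,
      (if a + m + k < a then 0 else if a + m + k < a + m then t else 0) * z (s (a + m + k))
      = 0 := by
    refine Finset.sum_eq_zero fun k hk => ?_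
    rw [if_neg (by omega), if_neg (by omega), zero_mul]
  rw [f1, f2, f3, zero_add, add_zero]

theorem PP_diff {N : ℕ} {v z : Fin N → ℝ} (n : ℕ) (hn : 0 < n)
    (m : ℕ) (h : n = m + m) (t : ℝ) :
    PP v n hn (fun s => Real.exp (t * (∑ k ∈ Finset.range m, z (s k) -
      ∑ k ∈ Finset.range m, z (s (m + k))))) = AA v z t ^ m * AA v z (-t) ^ m := by
  have key := PP_exp v z n hn (fun k => if k < m then t else -t)
  subst h
  simp only [Finset.sum_range_add, Finset.prod_range_add] at key
  have e1 : ∏ k ∈ Finset.range m, AA v z (if k < m then t else -t) = AA v z t ^ m := by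
    rw [Finset.prod_congr rfl (g := fun _ => AA v z t), Finset.prod_const, Finset.card_range]
    intro k hk
    rw [if_pos (Finset.mem_range.1 hk)]
  have e2 : ∏ k ∈ Finset.range m, AA v z (if m + k < m then t else -t) = AA v z (-t) ^ m := by
    rw [Finset.prod_congr rfl (g := fun _ => AA v z (-t)), Finset.prod_const, Finset.card_range]
    intro k hk
    rw [if_neg (by omega)]
  rw [e1, e2] at key
  rw [← key]
  congr 1
  funext s
  congr 1
  rw [mul_sub, sub_eq_add_neg, Finset.mul_sum, Finset.mul_sum, ← Finset.sum_neg_distrib]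
  congr 1
  · refine Finset.sum_congr rfl fun k hk => ?_
    rw [if_pos (Finset.mem_range.1 hk)]
  · refine Finset.sum_congr rfl fun k hk => ?_
    rw [if_neg (by omega)]; ring

theorem AA_nonneg {N : ℕ} {v z : Fin N → ℝ} (hv0 : ∀ j, 0 ≤ v j) (t : ℝ) : 0 ≤ AA v z t :=
  Finset.sum_nonneg fun j _ => mul_nonneg (hv0 j) (Real.exp_pos _).le

theorem AA_approx {N : ℕ} {v z : Fin N → ℝ} (hv0 : ∀ j, 0 ≤ v j) (hv : ∑ j, v j = 1)
    (hz : ∀ j, |z j| ≤ 1) {t : ℝ} (ht : |t| ≤ 1) :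
    |AA v z t - 1 - t * ∑ j, v j * z j| ≤ t ^ 2 := by
  have e : AA v z t - 1 - t * ∑ j, v j * z j
      = ∑ j, v j * (Real.exp (t * z j) - 1 - t * z j) := by
    have e1 : ∑ j, v j * (Real.exp (t * z j) - 1 - t * z j) =
        ∑ j, (v j * Real.exp (t * z j) - v j - t * (v j * z j)) :=
      Finset.sum_congr rfl fun j _ => by ring
    rw [e1, AA, Finset.mul_sum, Finset.sum_sub_distrib, Finset.sum_sub_distrib, hv]
  rw [e]
  calc _ ≤ ∑ j, |v j * (Real.exp (t * z j) - 1 - t * z j)| := Finset.abs_sum_le_sum_abs _ _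
    _ ≤ ∑ j, v j * t ^ 2 := by
      refine Finset.sum_le_sum fun j _ => ?_
      rw [abs_mul, abs_of_nonneg (hv0 j)]
      refine mul_le_mul_of_nonneg_left ?_ (hv0 j)
      have h1 : |t * z j| ≤ 1 := by
        rw [abs_mul]; exact mul_le_one₀ ht (abs_nonneg _) (hz j)
      refine (Real.abs_exp_sub_one_sub_id_le h1).trans ?_
      rw [mul_pow]
      have : z j ^ 2 ≤ 1 := by rw [sq_le_one_iff_abs_le_one]; exact hz j
      nlinarith [sq_nonneg t]
    _ = t ^ 2 := by rw [← Finset.sum_mul, hv, one_mul]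

theorem AA_tendsto {N : ℕ} {v z : Fin N → ℝ} (hv0 : ∀ j, 0 ≤ v j) (hv : ∑ j, v j = 1)
    (hz : ∀ j, |z j| ≤ 1) :
    Filter.Tendsto (fun n : ℕ => AA v z ((n : ℝ)⁻¹) ^ n) Filter.atTop
      (nhds (Real.exp (∑ j, v j * z j))) := by
  have h1 : Filter.Tendsto (fun n : ℕ => (n : ℝ) * (AA v z ((n : ℝ)⁻¹) - 1)) Filter.atTop
      (nhds (∑ j, v j * z j)) := by
    rw [tendsto_iff_norm_sub_tendsto_zero]
    refine squeeze_zero' (Filter.Eventually.of_forall fun _ => norm_nonneg _) ?_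
      (tendsto_inv_atTop_nhds_zero_nat (𝕜 := ℝ))
    filter_upwards [Filter.eventually_ge_atTop 1] with n hn
    have hn' : (1 : ℝ) ≤ n := by exact_mod_cast hn
    have hp : (0 : ℝ) < n := by linarith
    have ha := AA_approx hv0 hv hz (t := (n : ℝ)⁻¹) (by
      rw [abs_of_pos (inv_pos.2 hp)]; exact inv_le_one_of_one_le₀ hn')
    have e : (n : ℝ) * (AA v z ((n : ℝ)⁻¹) - 1) - ∑ j, v j * z j
        = n * (AA v z ((n : ℝ)⁻¹) - 1 - (n : ℝ)⁻¹ * ∑ j, v j * z j) := by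
      field_simp
    rw [e, Real.norm_eq_abs, abs_mul, abs_of_pos hp]
    calc _ ≤ (n : ℝ) * ((n : ℝ)⁻¹) ^ 2 := mul_le_mul_of_nonneg_left ha hp.le
      _ = _ := by field_simp
  have := Real.tendsto_one_add_pow_exp_of_tendsto h1
  simpa using this

theorem AA_le {N : ℕ} {v z : Fin N → ℝ} (hv0 : ∀ j, 0 ≤ v j) (hv : ∑ j, v j = 1)
    (hz : ∀ j, |z j| ≤ 1) {t : ℝ} (ht : |t| ≤ 1) :
    AA v z t * AA v z (-t) ≤ Real.exp (2 * t ^ 2) := by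
  have h1 := (abs_le.1 (AA_approx hv0 hv hz ht)).2
  have h2 := (abs_le.1 (AA_approx hv0 hv hz (t := -t) (by rwa [abs_neg]))).2
  set μ := ∑ j, v j * z j
  have h3 : AA v z t ≤ Real.exp (t * μ + t ^ 2) :=
    le_trans (by linarith) (Real.add_one_le_exp _)
  have h4 : AA v z (-t) ≤ Real.exp (-t * μ + t ^ 2) :=
    le_trans (by nlinarith) (Real.add_one_le_exp _)
  calc _ ≤ Real.exp (t * μ + t ^ 2) * Real.exp (-t * μ + t ^ 2) :=
        mul_le_mul h3 h4 (AA_nonneg hv0 _) (Real.exp_pos _).le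
    _ = _ := by rw [← Real.exp_add]; congr 1; ring

theorem pow4_le (y : ℝ) : y ^ 4 ≤ 24 * (Real.exp y + Real.exp (-y)) := by
  have h := Real.pow_div_factorial_le_exp |y| (abs_nonneg y) 4
  have e : |y| ^ 4 = y ^ 4 := by
    rw [show (4 : ℕ) = 2 * 2 from rfl, pow_mul, pow_mul, sq_abs]
  rw [e] at h
  have h2 : Real.exp |y| ≤ Real.exp y + Real.exp (-y) := by
    rcases abs_choice y with h | h <;> rw [h] <;> linarith [Real.exp_pos y, Real.exp_pos (-y)]
  norm_num [Nat.factorial] at h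
  linarith

theorem fourth {N : ℕ} {v z : Fin N → ℝ} (hv0 : ∀ j, 0 ≤ v j) (hv : ∑ j, v j = 1)
    (hz : ∀ j, |z j| ≤ 1) (n : ℕ) (hn : 0 < n) (m : ℕ) (h : n = m + m) :
    PP v n hn (fun s => ((m : ℝ)⁻¹ * ∑ k ∈ Finset.range m, z (s k) -
      (m : ℝ)⁻¹ * ∑ k ∈ Finset.range m, z (s (m + k))) ^ 4) ≤
      48 * Real.exp 2 / (m : ℝ) ^ 2 := by
  have hm : 1 ≤ m := by omega
  have hm' : (1 : ℝ) ≤ m := by exact_mod_cast hm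
  have hp : (0 : ℝ) < m := by linarith
  set t : ℝ := (Real.sqrt m)⁻¹ with ht
  have hs : Real.sqrt m ^ 2 = m := Real.sq_sqrt hp.le
  have hsp : 0 < Real.sqrt m := Real.sqrt_pos.2 hp
  have htp : 0 < t := inv_pos.2 hsp
  have ht2 : t ^ 2 = (m : ℝ)⁻¹ := by rw [ht, inv_pow, hs]
  have ht1 : |t| ≤ 1 := by
    rw [abs_of_pos htp]; exact inv_le_one_of_one_le₀ (Real.one_le_sqrt.2 hm')
  have hB : (AA v z t * AA v z (-t)) ^ m ≤ Real.exp 2 := by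
    calc _ ≤ (Real.exp (2 * t ^ 2)) ^ m :=
          pow_le_pow_left₀ (mul_nonneg (AA_nonneg hv0 _) (AA_nonneg hv0 _))
            (AA_le hv0 hv hz ht1) _
      _ = _ := by rw [← Real.exp_nat_mul, ht2]; congr 1; field_simp
  have step : ∀ s : ℕ → Fin N, ((m : ℝ)⁻¹ * ∑ k ∈ Finset.range m, z (s k) -
      (m : ℝ)⁻¹ * ∑ k ∈ Finset.range m, z (s (m + k))) ^ 4 ≤
      (24 / (m : ℝ) ^ 2) * (Real.exp (t * (∑ k ∈ Finset.range m, z (s k) -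
      ∑ k ∈ Finset.range m, z (s (m + k)))) + Real.exp (-t * (∑ k ∈ Finset.range m, z (s k) -
      ∑ k ∈ Finset.range m, z (s (m + k))))) := by
    intro s
    set S := ∑ k ∈ Finset.range m, z (s k) - ∑ k ∈ Finset.range m, z (s (m + k)) with hS
    have h4 := pow4_le (t * S)
    have e : (m : ℝ)⁻¹ * ∑ k ∈ Finset.range m, z (s k) -
      (m : ℝ)⁻¹ * ∑ k ∈ Finset.range m, z (s (m + k)) = t ^ 2 * S := by
      rw [ht2, hS]; ring
    rw [e]
    have e2 : (t ^ 2 * S) ^ 4 = ((m : ℝ) ^ 2)⁻¹ * (t * S) ^ 4 := by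
      rw [← inv_pow, ← ht2]; ring
    rw [e2]
    calc _ ≤ ((m : ℝ) ^ 2)⁻¹ * (24 * (Real.exp (t * S) + Real.exp (-(t * S)))) :=
          mul_le_mul_of_nonneg_left h4 (by positivity)
      _ = _ := by rw [neg_mul]; ring
  refine (PP_mono hv0 step).trans ?_
  rw [PP_mul, PP_add, PP_diff n hn m h, PP_diff n hn m h, neg_neg]
  rw [mul_pow] at hB
  calc _ ≤ (24 / (m : ℝ) ^ 2) * (Real.exp 2 + Real.exp 2) :=
        mul_le_mul_of_nonneg_left (by linarith) (by positivity)
    _ = _ := by ring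

theorem mean_abs {N : ℕ} {z : Fin N → ℝ} (hz : ∀ j, |z j| ≤ 1) (m : ℕ) (s : ℕ → Fin N) :
    |(m : ℝ)⁻¹ * ∑ k ∈ Finset.range m, z (s k)| ≤ 1 := by
  rw [abs_mul, abs_of_nonneg (by positivity)]
  have h : |∑ k ∈ Finset.range m, z (s k)| ≤ m := by
    refine (Finset.abs_sum_le_sum_abs _ _).trans ?_
    refine (Finset.sum_le_sum fun k _ => hz (s k)).trans ?_
    simp
  rcases Nat.eq_zero_or_pos m with h0 | h0
  · simp [h0]
  · have : (0 : ℝ) < m := by exact_mod_cast h0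
    rw [inv_mul_le_iff₀ this]; linarith

theorem exp_gap_nonpos (a b : ℝ) :
    Real.exp ((a + b) / 2) - (Real.exp a + Real.exp b) / 2 =
      -(Real.exp (a / 2) - Real.exp (b / 2)) ^ 2 / 2 := by
  have h1 : Real.exp ((a + b) / 2) = Real.exp (a / 2) * Real.exp (b / 2) := by
    rw [← Real.exp_add]; congr 1; ring
  have h2 : Real.exp a = Real.exp (a / 2) ^ 2 := by
    rw [← Real.exp_nat_mul]; congr 1; push_cast; ring
  have h3 : Real.exp b = Real.exp (b / 2) ^ 2 := by
    rw [← Real.exp_nat_mul]; congr 1; push_cast; ring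
  rw [h1, h2, h3]; ring

theorem exp_gap_sq {a b : ℝ} (ha : |a| ≤ 1) (hb : |b| ≤ 1) :
    (Real.exp ((a + b) / 2) - (Real.exp a + Real.exp b) / 2) ^ 2 ≤
      Real.exp 2 / 4 * (a - b) ^ 4 := by
  rw [exp_gap_nonpos]
  have ha' := abs_le.1 ha
  have hb' := abs_le.1 hb
  have hy : |(a - b) / 2| ≤ 1 := by rw [abs_le]; constructor <;> linarith
  have h1 := Real.abs_exp_sub_one_le hy
  have e : Real.exp (a / 2) - Real.exp (b / 2)
      = Real.exp (b / 2) * (Real.exp ((a - b) / 2) - 1) := by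
    rw [mul_sub, ← Real.exp_add, mul_one]; congr 2; ring
  have h2 : (Real.exp ((a - b) / 2) - 1) ^ 2 ≤ (a - b) ^ 2 := by
    rw [sq_le_sq]
    refine h1.trans (le_of_eq ?_)
    rw [abs_div]; norm_num; ring
  have h3 : Real.exp (b / 2) ^ 2 ≤ Real.exp 1 := by
    rw [← Real.exp_nat_mul]; apply Real.exp_le_exp.2; push_cast; linarith
  have h4 : (Real.exp (a / 2) - Real.exp (b / 2)) ^ 2 ≤ Real.exp 1 * (a - b) ^ 2 := by
    rw [e, mul_pow]
    exact mul_le_mul h3 h2 (sq_nonneg _) (Real.exp_pos _).le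
  have h5 := pow_le_pow_left₀ (sq_nonneg _) h4 2
  have h6 : Real.exp 2 = Real.exp 1 ^ 2 := by rw [← Real.exp_nat_mul]; norm_num
  rw [h6]
  calc _ = ((Real.exp (a / 2) - Real.exp (b / 2)) ^ 2) ^ 2 / 4 := by ring
    _ ≤ (Real.exp 1 * (a - b) ^ 2) ^ 2 / 4 := by linarith
    _ = _ := by ring

theorem sqrt8_bd : 2 < Real.sqrt 8 ∧ Real.sqrt 8 ≤ 3 := by
  constructor
  · rw [Real.lt_sqrt (by norm_num)]; norm_num
  · rw [Real.sqrt_le_left (by norm_num)]; norm_num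

theorem alpha_bd : 0 < (Real.sqrt 8)⁻¹ ∧ (Real.sqrt 8)⁻¹ < 1 / 2 := by
  obtain ⟨h, _⟩ := sqrt8_bd
  refine ⟨by positivity, ?_⟩
  rw [inv_lt_comm₀ (by positivity) (by norm_num)]
  norm_num; exact h

theorem geomP_pos (j : ℕ) : 0 < geomP j := by
  obtain ⟨h1, h2⟩ := alpha_bd
  unfold geomP
  exact mul_pos (by linarith) (pow_pos h1 _)

theorem geomP_hasSum : HasSum geomP 1 := by
  obtain ⟨h1, h2⟩ := alpha_bd
  have := (hasSum_geometric_of_lt_one h1.le (by linarith)).mul_left (1 - (Real.sqrt 8)⁻¹)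
  rw [mul_inv_cancel₀ (by linarith)] at this
  exact this

theorem geomP_inv (j : ℕ) : (geomP j)⁻¹ / 4 ^ j ≤ 2 * (3 / 4 : ℝ) ^ j := by
  obtain ⟨h1, h2⟩ := alpha_bd
  obtain ⟨h3, h4⟩ := sqrt8_bd
  unfold geomP
  rw [mul_inv, inv_pow, inv_inv, mul_div_assoc, ← div_pow]
  refine mul_le_mul ?_ (pow_le_pow_left₀ (by positivity) (by linarith) _) (by positivity)
    (by norm_num)
  rw [inv_le_comm₀ (by linarith) (by norm_num)]; linarith

theorem core {N : ℕ} {v z : Fin N → ℝ} (hv0 : ∀ j, 0 ≤ v j) (hv : ∑ j, v j = 1)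
    (hz : ∀ j, |z j| ≤ 1) (K : ℝ) (hK : 0 ≤ K) (V : ℕ → (ℕ → Fin N) → ℝ)
    (g : ℕ → (ℕ → Fin N) → ℝ)
    (hg : ∀ m s, g m s = K * Real.exp ((m : ℝ)⁻¹ * ∑ k ∈ Finset.range m, z (s k)))
    (hV : ∀ j s, V j s = g 1 s + (if j = 0 then 0 else
      g (2 * 2 ^ (j - 1)) s - (g (2 ^ (j - 1)) s + g (2 ^ (j - 1)) (fun k => s (2 ^ (j - 1) + k))) / 2)
        / geomP j) :
    HasSum (fun j => geomP j * PP v (2 ^ j) (Nat.two_pow_pos j) (V j))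
      (K * Real.exp (∑ j, v j * z j)) ∧
    Summable (fun j => geomP j * PP v (2 ^ j) (Nat.two_pow_pos j) (fun s => V j s ^ 2)) ∧
    ∑' j, geomP j * PP v (2 ^ j) (Nat.two_pow_pos j) (fun s => V j s ^ 2) ≤
      K ^ 2 * (2 * Real.exp 2 + 768 * Real.exp 4) := by
  set D : ℕ → (ℕ → Fin N) → ℝ := fun m s =>
    g (2 * m) s - (g m s + g m (fun k => s (m + k))) / 2 with hD
  have hDexp : ∀ m : ℕ, 0 < m → ∀ s, D m s =
      K * (Real.exp (((m : ℝ)⁻¹ * ∑ k ∈ Finset.range m, z (s k) +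
        (m : ℝ)⁻¹ * ∑ k ∈ Finset.range m, z (s (m + k))) / 2) -
        (Real.exp ((m : ℝ)⁻¹ * ∑ k ∈ Finset.range m, z (s k)) +
        Real.exp ((m : ℝ)⁻¹ * ∑ k ∈ Finset.range m, z (s (m + k)))) / 2) := by
    intro m hm s
    have hm' : (m : ℝ) ≠ 0 := by positivity
    simp only [hD, hg]
    have e : (((2 * m : ℕ) : ℝ))⁻¹ * ∑ k ∈ Finset.range (2 * m), z (s k) =
        ((m : ℝ)⁻¹ * ∑ k ∈ Finset.range m, z (s k) +
        (m : ℝ)⁻¹ * ∑ k ∈ Finset.range m, z (s (m + k))) / 2 := by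
      rw [two_mul, Finset.sum_range_add]; push_cast; field_simp; ring
    rw [e]; ring
  set A : ℕ → ℝ := fun j => AA v z (((2 ^ j : ℕ) : ℝ)⁻¹) ^ (2 ^ j) with hA
  have hblock : ∀ (n : ℕ) (hn : 0 < n) (a m b : ℕ), n = a + m + b →
      PP v n hn (fun s => g m (fun k => s (a + k))) = K * AA v z ((m : ℝ)⁻¹) ^ m := by
    intro n hn a m b h
    simp only [hg]
    rw [PP_mul, PP_block hv n hn a m b h]
  have hblock0 : ∀ (n : ℕ) (hn : 0 < n) (m b : ℕ), n = m + b →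
      PP v n hn (g m) = K * AA v z ((m : ℝ)⁻¹) ^ m := by
    intro n hn m b h
    have := hblock n hn 0 m b (by omega)
    simpa using this
  have hg1 : ∀ j, PP v (2 ^ j) (Nat.two_pow_pos j) (g 1) = K * A 0 := by
    intro j
    rw [hblock0 _ _ 1 (2 ^ j - 1) (by have := Nat.two_pow_pos j; omega)]
    simp [hA]
  have hPD : ∀ j, PP v (2 ^ (j + 1)) (Nat.two_pow_pos (j + 1)) (D (2 ^ j)) =
      K * (A (j + 1) - A j) := by
    intro j
    have e : D (2 ^ j) = fun s => g (2 * 2 ^ j) s + ((-1 / 2) * g (2 ^ j) s +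
        (-1 / 2) * g (2 ^ j) (fun k => s (2 ^ j + k))) := by
      funext s; simp only [hD]; ring
    rw [e, PP_add, PP_add, PP_mul, PP_mul, hblock0 _ _ (2 * 2 ^ j) 0 (by rw [pow_succ]; ring),
      hblock0 _ _ (2 ^ j) (2 ^ j) (by rw [pow_succ]; ring),
      hblock _ _ (2 ^ j) (2 ^ j) 0 (by rw [pow_succ]; ring)]
    simp only [hA]
    rw [show 2 ^ (j + 1) = 2 * 2 ^ j by rw [pow_succ]; ring]
    ring
  have hDneg : ∀ m : ℕ, 0 < m → ∀ s, D m s ≤ 0 := by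
    intro m hm s
    rw [hDexp m hm s, exp_gap_nonpos]
    refine mul_nonpos_of_nonneg_of_nonpos hK ?_
    apply div_nonpos_of_nonpos_of_nonneg _ (by norm_num)
    exact neg_nonpos.2 (sq_nonneg _)
  have hmono : ∀ j, 0 ≤ K * (A j - A (j + 1)) := by
    intro j
    have h1 := PP_mono hv0 (n := 2 ^ (j + 1)) (hn := Nat.two_pow_pos _)
      (hDneg (2 ^ j) (Nat.two_pow_pos j))
    rw [hPD, PP_const hv] at h1
    linarith
  have hAlim : Filter.Tendsto A Filter.atTop (nhds (Real.exp (∑ j, v j * z j))) :=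
    (AA_tendsto hv0 hv hz).comp (tendsto_pow_atTop_atTop_of_one_lt (by norm_num : 1 < 2))
  have htel : HasSum (fun j => K * (A j - A (j + 1))) (K * (A 0 - Real.exp (∑ j, v j * z j))) := by
    rw [hasSum_iff_tendsto_nat_of_nonneg hmono]
    have e : (fun n => ∑ j ∈ Finset.range n, K * (A j - A (j + 1))) =
        fun n => K * (A 0 - A n) := by
      funext n
      rw [← Finset.mul_sum, Finset.sum_range_sub']
    rw [e]
    exact (tendsto_const_nhds.sub hAlim).const_mul K
  refine ⟨?_, ?_⟩
  · set T : ℕ → ℝ := fun j => if j = 0 then 0 else K * (A j - A (j - 1)) with hT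
    have hTs : HasSum T (K * (Real.exp (∑ j, v j * z j) - A 0)) := by
      rw [← hasSum_nat_add_iff' 1]
      have e : (fun n => T (n + 1)) = fun j => -(K * (A j - A (j + 1))) := by
        funext j; simp only [hT]; rw [if_neg (by omega), Nat.add_sub_cancel]; ring
      rw [e]
      convert htel.neg using 1
      simp [hT]; ring
    have := (geomP_hasSum.mul_right (K * A 0)).add hTs
    have e0 : 1 * (K * A 0) + K * (Real.exp (∑ j, v j * z j) - A 0) =
        K * Real.exp (∑ j, v j * z j) := by ring
    rw [e0] at this
    have e9 : (fun j => geomP j * PP v (2 ^ j) (Nat.two_pow_pos j) (V j)) =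
        fun b => geomP b * (K * A 0) + T b := by
      funext j
      have hp := (geomP_pos j).ne'
      rcases j with _ | j
      · have e : V 0 = g 1 := by funext s; rw [hV]; simp
        rw [e, hg1]; simp [hT]
      · have e : V (j + 1) = fun s => g 1 s + (geomP (j + 1))⁻¹ * D (2 ^ j) s := by
          funext s; rw [hV, if_neg (by omega), Nat.add_sub_cancel, div_eq_inv_mul]
        rw [e, PP_add, PP_mul, hg1, hPD]
        simp only [hT]
        rw [if_neg (by omega), Nat.add_sub_cancel]
        field_simp
    rw [e9]; exact this
  · have hgsq : ∀ s, g 1 s ^ 2 ≤ K ^ 2 * Real.exp 2 := by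
      intro s
      rw [hg, mul_pow, ← Real.exp_nat_mul]
      refine mul_le_mul_of_nonneg_left ?_ (sq_nonneg _)
      apply Real.exp_le_exp.2
      have := (abs_le.1 (mean_abs hz 1 s)).2
      push_cast at this ⊢
      linarith
    have hDsq : ∀ j, PP v (2 ^ (j + 1)) (Nat.two_pow_pos (j + 1)) (fun s => D (2 ^ j) s ^ 2) ≤
        K ^ 2 * (48 * Real.exp 4 / 4 ^ (j + 1)) := by
      intro j
      have hb : ∀ s, D (2 ^ j) s ^ 2 ≤ (K ^ 2 * (Real.exp 2 / 4)) *
          ((((2 ^ j : ℕ) : ℝ))⁻¹ * ∑ k ∈ Finset.range (2 ^ j), z (s k) -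
            (((2 ^ j : ℕ) : ℝ))⁻¹ * ∑ k ∈ Finset.range (2 ^ j), z (s (2 ^ j + k))) ^ 4 := by
        intro s
        rw [hDexp _ (Nat.two_pow_pos j), mul_pow, mul_assoc]
        exact mul_le_mul_of_nonneg_left (exp_gap_sq (mean_abs hz _ s)
          (mean_abs hz _ (fun k => s (2 ^ j + k)))) (sq_nonneg _)
      refine (PP_mono hv0 hb).trans ?_
      rw [PP_mul]
      have h4 := fourth hv0 hv hz (2 ^ (j + 1)) (Nat.two_pow_pos (j + 1)) (2 ^ j)
        (by rw [pow_succ]; ring)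
      refine (mul_le_mul_of_nonneg_left h4 (by positivity)).trans (le_of_eq ?_)
      have e4 : Real.exp 4 = Real.exp 2 ^ 2 := by rw [← Real.exp_nat_mul]; norm_num
      have e5 : (((2 ^ j : ℕ) : ℝ)) ^ 2 = 4 ^ j := by
        push_cast; rw [← pow_mul, mul_comm, pow_mul]; norm_num
      rw [e4, e5, pow_succ]
      field_simp
      ring
    have hbd : ∀ j, geomP j * PP v (2 ^ j) (Nat.two_pow_pos j) (fun s => V j s ^ 2) ≤
        geomP j * (2 * K ^ 2 * Real.exp 2) + (192 * K ^ 2 * Real.exp 4) * (3 / 4 : ℝ) ^ j := by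
      intro j
      have hp := geomP_pos j
      rcases j with _ | j
      · have h1 : PP v (2 ^ 0) (Nat.two_pow_pos 0) (fun s => V 0 s ^ 2) ≤ K ^ 2 * Real.exp 2 := by
          rw [← PP_const hv (2 ^ 0) (Nat.two_pow_pos 0) (K ^ 2 * Real.exp 2)]
          refine PP_mono hv0 fun s => ?_
          rw [hV]; simpa using hgsq s
        have h2 := mul_le_mul_of_nonneg_left h1 hp.le
        have h3 : 0 ≤ geomP 0 * (K ^ 2 * Real.exp 2) := by positivity
        have h4 : 0 ≤ (192 * K ^ 2 * Real.exp 4) * (3 / 4 : ℝ) ^ 0 := by positivity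
        linarith
      · have h1 : PP v (2 ^ (j + 1)) (Nat.two_pow_pos (j + 1)) (fun s => V (j + 1) s ^ 2) ≤
            2 * K ^ 2 * Real.exp 2 +
              (2 * ((geomP (j + 1))⁻¹) ^ 2) * (K ^ 2 * (48 * Real.exp 4 / 4 ^ (j + 1))) := by
          refine le_trans (PP_mono hv0 (H := fun s => 2 * K ^ 2 * Real.exp 2 +
              (2 * ((geomP (j + 1))⁻¹) ^ 2) * D (2 ^ j) s ^ 2) fun s => ?_) ?_
          · have e : V (j + 1) s = g 1 s + (geomP (j + 1))⁻¹ * D (2 ^ j) s := by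
              rw [hV, if_neg (by omega), Nat.add_sub_cancel, div_eq_inv_mul]
            rw [e]
            nlinarith [hgsq s, sq_nonneg (g 1 s - (geomP (j + 1))⁻¹ * D (2 ^ j) s)]
          · rw [PP_add, PP_const hv, PP_mul]
            have := mul_le_mul_of_nonneg_left (hDsq j)
              (by positivity : 0 ≤ 2 * ((geomP (j + 1))⁻¹) ^ 2)
            linarith
        refine (mul_le_mul_of_nonneg_left h1 hp.le).trans ?_
        rw [mul_add]
        have e : geomP (j + 1) * ((2 * ((geomP (j + 1))⁻¹) ^ 2) *
            (K ^ 2 * (48 * Real.exp 4 / 4 ^ (j + 1)))) =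
            (96 * K ^ 2 * Real.exp 4) * ((geomP (j + 1))⁻¹ / 4 ^ (j + 1)) := by
          field_simp; ring
        rw [e]
        have := mul_le_mul_of_nonneg_left (geomP_inv (j + 1))
          (by positivity : 0 ≤ 96 * K ^ 2 * Real.exp 4)
        linarith
    have hgeo : HasSum (fun j : ℕ => (3 / 4 : ℝ) ^ j) 4 := by
      have := hasSum_geometric_of_lt_one (r := (3 / 4 : ℝ)) (by norm_num) (by norm_num)
      norm_num at this
      exact this
    have hS := (geomP_hasSum.mul_right (2 * K ^ 2 * Real.exp 2)).add
      (hgeo.mul_left (192 * K ^ 2 * Real.exp 4))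
    have hnn : ∀ j, 0 ≤ geomP j * PP v (2 ^ j) (Nat.two_pow_pos j) (fun s => V j s ^ 2) := by
      intro j
      refine mul_nonneg (geomP_pos j).le ?_
      unfold PP
      exact Finset.sum_nonneg fun s _ => mul_nonneg (Finset.prod_nonneg fun _ _ => hv0 _)
        (sq_nonneg _)
    have hsum := Summable.of_nonneg_of_le hnn hbd hS.summable
    refine ⟨hsum, ?_⟩
    refine (hsum.tsum_le_tsum hbd hS.summable).trans (le_of_eq ?_)
    rw [hS.tsum_eq]; ring

end Helpers

/-- For convex `G`-Lipschitz losses, `0 < r ≤ ε'/G`, `0 < λ ≤ G/r` and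
`x ∈ B_r(x̄) ∩ 𝒳`, the MLMC estimator `M̂[γ_i(x)]` is unbiased, its second moment is bounded by
`C (G⁴‖x − x̄‖⁴/ε'² + ε'²)` for an absolute constant `C`, and `E[2^J]` is bounded by an absolute
constant (so the expected number of loss evaluations is `O(1)`). -/
theorem stmt2 :
    ∃ C C' : ℝ, 0 < C ∧ 0 < C' ∧
      Summable (fun j : ℕ => geomP j * (2 ^ j : ℝ)) ∧
      (∑' j : ℕ, geomP j * (2 ^ j : ℝ)) ≤ C' ∧
      ∀ (d N M : ℕ) (_ : 2 ≤ M)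
        (𝒳 : Set (EuclideanSpace ℝ (Fin d))) (_ : Convex ℝ 𝒳) (_ : IsClosed 𝒳)
        (ℓ : Fin N → EuclideanSpace ℝ (Fin d) → ℝ)
        (w : Fin M → Fin N → ℝ) (_ : ∀ i, w i ∈ stdSimplex ℝ (Fin N))
        (G ε ε' lam r : ℝ) (_ : 0 < G) (_ : 0 < ε)
        (_ : ε' = ε / (2 * Real.log (M : ℝ)))
        (_ : ∀ j, ConvexOn ℝ 𝒳 (ℓ j))
        (_ : ∀ j, ∀ z ∈ 𝒳, ∀ z' ∈ 𝒳, |ℓ j z - ℓ j z'| ≤ G * ‖z - z'‖)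
        (_ : 0 < r) (_ : r ≤ ε' / G) (_ : 0 < lam) (_ : lam ≤ G / r)
        (xbar : EuclideanSpace ℝ (Fin d)) (_ : xbar ∈ 𝒳)
        (x : EuclideanSpace ℝ (Fin d)) (_ : x ∈ Metric.closedBall xbar r ∩ 𝒳)
        (i : Fin M),
        Summable (mlmcSummand w i (mlmcVal ℓ ε' lam xbar x xbar)) ∧
        mlmcExp w i (mlmcVal ℓ ε' lam xbar x xbar) =
          ε' * Real.exp ((groupLoss w ℓ i x - groupLoss w ℓ i xbar +
            lam / 2 * ‖x - xbar‖ ^ 2) / ε') ∧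
        Summable (mlmcSummand w i (fun j s => (mlmcVal ℓ ε' lam xbar x xbar j s) ^ 2)) ∧
        mlmcExp w i (fun j s => (mlmcVal ℓ ε' lam xbar x xbar j s) ^ 2) ≤
          C * (G ^ 4 * ‖x - xbar‖ ^ 4 / ε' ^ 2 + ε' ^ 2) := by
  have hs2 : Summable (fun j : ℕ => geomP j * (2 ^ j : ℝ)) := by
    obtain ⟨h1, h2⟩ := alpha_bd
    have := (summable_geometric_of_lt_one (r := (Real.sqrt 8)⁻¹ * 2) (by positivity)
      (by linarith)).mul_left (1 - (Real.sqrt 8)⁻¹)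
    refine this.congr fun j => ?_
    rw [geomP, mul_pow]; ring
  refine ⟨Real.exp 1 * (2 * Real.exp 2 + 768 * Real.exp 4),
    |∑' j : ℕ, geomP j * (2 ^ j : ℝ)| + 1, by positivity, by positivity, hs2,
    (le_abs_self _).trans (by linarith), ?_⟩
  intro d N M _ 𝒳 _ _ ℓ w hw G ε ε' lam r hG _ _ _ hL hr hrε hlam hlamr xbar hxb x hx i
  have hε : 0 < ε' := by
    have h1 : 0 < ε' / G := lt_of_lt_of_le hr hrε
    have := mul_pos h1 hG
    rwa [div_mul_cancel₀ _ hG.ne'] at this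
  have hxr : ‖x - xbar‖ ≤ r := by
    have := hx.1
    rwa [Metric.mem_closedBall, dist_eq_norm] at this
  have hGr : G * r ≤ ε' := by
    rw [le_div_iff₀ hG] at hrε; linarith
  set z : Fin N → ℝ := fun j => (ℓ j x - ℓ j xbar) / ε' with hzdef
  have hz : ∀ j, |z j| ≤ 1 := by
    intro j
    simp only [hzdef]
    rw [abs_div, abs_of_pos hε, div_le_one hε]
    exact (hL j x hx.2 xbar hxb).trans ((mul_le_mul_of_nonneg_left hxr hG.le).trans hGr)
  set c : ℝ := lam / 2 * ‖x - xbar‖ ^ 2 / ε' with hc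
  have hc1 : c ≤ 1 / 2 := by
    rw [hc, div_le_iff₀ hε]
    have h1 : ‖x - xbar‖ ^ 2 ≤ r ^ 2 := pow_le_pow_left₀ (norm_nonneg _) hxr 2
    have h2 : lam * r ≤ G := by rwa [le_div_iff₀ hr] at hlamr
    have h3 : lam / 2 * ‖x - xbar‖ ^ 2 ≤ lam / 2 * r ^ 2 :=
      mul_le_mul_of_nonneg_left h1 (by positivity)
    have h4 : lam * r * r ≤ G * r := mul_le_mul_of_nonneg_right h2 hr.le
    nlinarith
  set K : ℝ := ε' * Real.exp c with hKdef
  have hK : 0 ≤ K := by positivity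
  have hK2 : K ^ 2 ≤ ε' ^ 2 * Real.exp 1 := by
    rw [hKdef, mul_pow, ← Real.exp_nat_mul]
    refine mul_le_mul_of_nonneg_left (Real.exp_le_exp.2 ?_) (sq_nonneg _)
    push_cast; linarith
  obtain ⟨c1, c2, c3⟩ := core (v := w i) (z := z) (hw i).1 (hw i).2 hz K hK
    (mlmcVal ℓ ε' lam xbar x xbar) (gammaHat ℓ ε' lam xbar x xbar)
    (by
      intro m s
      rw [gammaHat, hKdef, mul_assoc, ← Real.exp_add]
      congr 2
      simp only [hzdef, hc]
      rw [← Finset.sum_div]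
      ring)
    (by intro j s; rfl)
  have hfin : K * Real.exp (∑ j, w i j * z j) =
      ε' * Real.exp ((groupLoss w ℓ i x - groupLoss w ℓ i xbar +
            lam / 2 * ‖x - xbar‖ ^ 2) / ε') := by
    rw [hKdef, mul_assoc, ← Real.exp_add]
    congr 2
    have e : ∑ j, w i j * z j = (groupLoss w ℓ i x - groupLoss w ℓ i xbar) / ε' := by
      simp only [groupLoss, hzdef]
      rw [← Finset.sum_sub_distrib, Finset.sum_div]
      refine Finset.sum_congr rfl fun j _ => by ring
    rw [e, hc]; ring
  refine ⟨c1.summable, c1.tsum_eq.trans hfin, c2, le_trans c3 ?_⟩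
  have hp : 0 ≤ 2 * Real.exp 2 + 768 * Real.exp 4 := by positivity
  have h1 := mul_le_mul_of_nonneg_right hK2 hp
  have h2 : 0 ≤ Real.exp 1 * (2 * Real.exp 2 + 768 * Real.exp 4) *
      (G ^ 4 * ‖x - xbar‖ ^ 4 / ε' ^ 2) := by positivity
  rw [mul_add]
  linarith
end
end

section
/- Assume each ℓ_j is convex and G-Lipschitz, let 0 < r ≤ ε'/G, 0 < λ ≤ G/r, and let x, x', x̄ ∈ 𝒳 satisfy ‖x − x'‖ ≤ 2r and ‖x − x̄‖ ≤ r. Let n ≥ 2 be even, i ∈ [M], and let S₁,…,Sₙ be i.i.d. samples from [N] with law w_i. Then there is an absolute constant C such that E|D̂_n|² ≤ C G⁴‖x − x'‖⁴/(n² ε'²). -/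
open Real

noncomputable section

theorem aux_moments {N : ℕ} (p : Fin N → ℝ) (hp : ∀ j, 0 ≤ p j) (hp1 : ∑ j, p j = 1) (K : ℝ)
    (n : ℕ) : ∀ (f : Fin n → Fin N → ℝ) (_ : ∀ k, ∑ j, p j * f k j = 0)
      (_ : ∀ k j, |f k j| ≤ K),
      (∑ s : Fin n → Fin N, (∏ k, p (s k)) = 1) ∧
      (∑ s : Fin n → Fin N, (∏ k, p (s k)) * (∑ k, f k (s k)) = 0) ∧
      (∑ s : Fin n → Fin N, (∏ k, p (s k)) * (∑ k, f k (s k)) ^ 2 ≤ n * K ^ 2) ∧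
      (∑ s : Fin n → Fin N, (∏ k, p (s k)) * (∑ k, f k (s k)) ^ 4 ≤ 3 * n ^ 2 * K ^ 4) := by
  induction n with
  | zero => intro f _ _; simp
  | succ n ih =>
    intro f h0 hK
    obtain ⟨i0, i1, i2, i4⟩ := ih (fun k => f k.succ) (fun k => h0 k.succ) (fun k => hK k.succ)
    have key : ∀ F : (Fin (n+1) → Fin N) → ℝ, ∑ s, F s
        = ∑ j : Fin N, ∑ t : Fin n → Fin N, F (Fin.cons j t) := by
      intro F
      rw [← (Fin.consEquiv (fun _ : Fin (n+1) => Fin N)).sum_comp, Fintype.sum_prod_type]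
      rfl
    have pm : ∀ q : ℕ, Even q → ∑ j, p j * f 0 j ^ q ≤ K ^ q := by
      intro q hq
      calc ∑ j, p j * f 0 j ^ q ≤ ∑ j, p j * K ^ q := by
            apply Finset.sum_le_sum
            intro j _
            apply mul_le_mul_of_nonneg_left _ (hp j)
            rw [← hq.pow_abs]
            exact pow_le_pow_left₀ (abs_nonneg _) (hK 0 j) q
        _ = K ^ q := by rw [← Finset.sum_mul, hp1, one_mul]
    have pn : 0 ≤ ∑ j, p j * f 0 j ^ 2 :=
      Finset.sum_nonneg fun j _ => mul_nonneg (hp j) (sq_nonneg _)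
    have h2 := pm 2 (by decide)
    have h4 := pm 4 (by decide)
    have m1 := h0 0
    set P : (Fin n → Fin N) → ℝ := fun t => ∏ k, p (t k) with hP
    set S : (Fin n → Fin N) → ℝ := fun t => ∑ k, f k.succ (t k) with hS
    have i0' : ∑ t, P t = 1 := i0
    have i1' : ∑ t, P t * S t = 0 := i1
    have i2' : ∑ t, P t * S t ^ 2 ≤ n * K ^ 2 := i2
    have i4' : ∑ t, P t * S t ^ 4 ≤ 3 * n ^ 2 * K ^ 4 := i4
    have e0 : ∑ s : Fin (n+1) → Fin N, (∏ k, p (s k)) = (∑ j, p j) * ∑ t, P t := by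
      rw [key, Finset.sum_mul_sum]
      simp [Fin.prod_univ_succ, hP]
    have e1 : ∑ s : Fin (n+1) → Fin N, (∏ k, p (s k)) * (∑ k, f k (s k))
        = (∑ j, p j * f 0 j) * (∑ t, P t) + (∑ j, p j) * ∑ t, P t * S t := by
      rw [key]
      simp only [Fin.prod_univ_succ, Fin.sum_univ_succ, Fin.cons_zero, Fin.cons_succ,
        Finset.sum_mul_sum, ← Finset.sum_add_distrib]
      refine Finset.sum_congr rfl fun j _ => Finset.sum_congr rfl fun t _ => ?_
      simp only [hP, hS]; ring
    have e2 : ∑ s : Fin (n+1) → Fin N, (∏ k, p (s k)) * (∑ k, f k (s k)) ^ 2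
        = (∑ j, p j * f 0 j ^ 2) * (∑ t, P t) + 2 * ((∑ j, p j * f 0 j) * ∑ t, P t * S t)
          + (∑ j, p j) * ∑ t, P t * S t ^ 2 := by
      rw [key]
      simp only [Fin.prod_univ_succ, Fin.sum_univ_succ, Fin.cons_zero, Fin.cons_succ,
        Finset.sum_mul_sum]
      simp only [Finset.mul_sum, ← Finset.sum_add_distrib]
      refine Finset.sum_congr rfl fun j _ => Finset.sum_congr rfl fun t _ => ?_
      simp only [hP, hS]; ring
    have e4 : ∑ s : Fin (n+1) → Fin N, (∏ k, p (s k)) * (∑ k, f k (s k)) ^ 4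
        = (∑ j, p j * f 0 j ^ 4) * (∑ t, P t) + 4 * ((∑ j, p j * f 0 j ^ 3) * ∑ t, P t * S t)
          + 6 * ((∑ j, p j * f 0 j ^ 2) * ∑ t, P t * S t ^ 2)
          + 4 * ((∑ j, p j * f 0 j) * ∑ t, P t * S t ^ 3)
          + (∑ j, p j) * ∑ t, P t * S t ^ 4 := by
      rw [key]
      simp only [Fin.prod_univ_succ, Fin.sum_univ_succ, Fin.cons_zero, Fin.cons_succ,
        Finset.sum_mul_sum]
      simp only [Finset.mul_sum, ← Finset.sum_add_distrib]
      refine Finset.sum_congr rfl fun j _ => Finset.sum_congr rfl fun t _ => ?_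
      simp only [hP, hS]; ring
    rw [e0, e1, e2, e4, i0', i1', hp1, m1]
    push_cast
    refine ⟨by ring, by ring, by nlinarith, ?_⟩
    have : (∑ j, p j * f 0 j ^ 2) * ∑ t, P t * S t ^ 2 ≤ K ^ 2 * (n * K ^ 2) := by
      calc _ ≤ (∑ j, p j * f 0 j ^ 2) * (n * K ^ 2) := mul_le_mul_of_nonneg_left i2' pn
        _ ≤ _ := mul_le_mul_of_nonneg_right h2 (by positivity)
    have hK4 : 0 ≤ K ^ 4 := by positivity
    nlinarith

theorem aux_exp_lip (u v : ℝ) (hu : u ≤ 1) (hv : v ≤ 1) :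
    |Real.exp u - Real.exp v| ≤ Real.exp 1 * |u - v| := by
  have main : ∀ a b : ℝ, a ≤ 1 → b ≤ a → Real.exp a - Real.exp b ≤ Real.exp 1 * (a - b) := by
    intro a b ha hb
    have h1 : Real.exp b = Real.exp a * Real.exp (b - a) := by rw [← Real.exp_add]; ring_nf
    have h2 := Real.add_one_le_exp (b - a)
    have h3 := Real.exp_le_exp.mpr ha
    have h4 := Real.exp_pos a
    rw [h1]
    nlinarith
  rcases le_total v u with h | h
  · rw [abs_of_nonneg (sub_nonneg.mpr (Real.exp_le_exp.mpr h)), abs_of_nonneg (sub_nonneg.mpr h)]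
    exact main u v hu h
  · rw [abs_sub_comm, abs_sub_comm u v, abs_of_nonneg (sub_nonneg.mpr (Real.exp_le_exp.mpr h)),
      abs_of_nonneg (sub_nonneg.mpr h)]
    exact main v u hv h

theorem aux_point (e c a b : ℝ) (hc : c ≤ 1 / 2) (ha : a ≤ 2) (hb : b ≤ 2) :
    (e * Real.exp ((a + b) / 2 + c) - (e * Real.exp (a + c) + e * Real.exp (b + c)) / 2) ^ 2
      ≤ e ^ 2 * Real.exp 1 ^ 5 / 64 * (a - b) ^ 4 := by
  have h := aux_exp_lip (a / 2) (b / 2) (by linarith) (by linarith)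
  have e1 : Real.exp ((a + b) / 2 + c) = Real.exp (a/2) * Real.exp (b/2) * Real.exp c := by
    rw [← Real.exp_add, ← Real.exp_add]; ring_nf
  have e2 : Real.exp (a + c) = Real.exp (a/2) ^ 2 * Real.exp c := by
    rw [← Real.exp_nat_mul, ← Real.exp_add]; push_cast; ring_nf
  have e3 : Real.exp (b + c) = Real.exp (b/2) ^ 2 * Real.exp c := by
    rw [← Real.exp_nat_mul, ← Real.exp_add]; push_cast; ring_nf
  have e4 : Real.exp c ^ 2 ≤ Real.exp 1 := by
    rw [← Real.exp_nat_mul]; apply Real.exp_le_exp.mpr; push_cast; linarith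
  have h4 := pow_le_pow_left₀ (abs_nonneg _) h 4
  rw [mul_pow, Even.pow_abs (by decide), Even.pow_abs (by decide)] at h4
  rw [e1, e2, e3]
  set A := Real.exp (a/2)
  set B := Real.exp (b/2)
  calc _ = e ^ 2 / 4 * (Real.exp c ^ 2 * (A - B) ^ 4) := by ring
    _ ≤ e ^ 2 / 4 * (Real.exp 1 * (Real.exp 1 ^ 4 * (a / 2 - b / 2) ^ 4)) := by
        gcongr
    _ = _ := by ring

/-- For convex `G`-Lipschitz losses, `0 < r ≤ ε'/G`, `0 < λ ≤ G/r`,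
`‖x − x'‖ ≤ 2r`, `‖x − x̄‖ ≤ r`, even `n = 2m ≥ 2`, and `S₁,…,Sₙ` i.i.d. with law `w_i`,
there is an absolute constant `C` with `E|D̂_n|² ≤ C G⁴‖x − x'‖⁴/(n² ε'²)`. -/
theorem stmt4 :
    ∃ C : ℝ, 0 < C ∧
    ∀ (d N M : ℕ)
      (𝒳 : Set (EuclideanSpace ℝ (Fin d))) (_ : Convex ℝ 𝒳) (_ : IsClosed 𝒳)
      (ℓ : Fin N → EuclideanSpace ℝ (Fin d) → ℝ)
      (w : Fin M → Fin N → ℝ) (_ : ∀ i, w i ∈ stdSimplex ℝ (Fin N))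
      (G ε ε' lam r : ℝ) (_ : 2 ≤ M) (_ : 0 < G) (_ : 0 < ε)
      (_ : ε' = ε / (2 * Real.log (M : ℝ)))
      (_ : ∀ j, ConvexOn ℝ 𝒳 (ℓ j))
      (_ : ∀ j, ∀ z ∈ 𝒳, ∀ z' ∈ 𝒳, |ℓ j z - ℓ j z'| ≤ G * ‖z - z'‖)
      (_ : 0 < r) (_ : r ≤ ε' / G) (_ : 0 < lam) (_ : lam ≤ G / r)
      (x x' xbar : EuclideanSpace ℝ (Fin d))
      (_ : x ∈ 𝒳) (_ : x' ∈ 𝒳) (_ : xbar ∈ 𝒳)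
      (_ : ‖x - x'‖ ≤ 2 * r) (_ : ‖x - xbar‖ ≤ r)
      (i : Fin M) (m : ℕ) (hm : 1 ≤ m),
      (∑ s : Fin (2 * m) → Fin N, (∏ k, w i (s k)) *
          (dHat ℓ ε' lam xbar x x' m (extSeq (by omega : 0 < 2 * m) s)) ^ 2)
        ≤ C * G ^ 4 * ‖x - x'‖ ^ 4 / ((2 * m : ℝ) ^ 2 * ε' ^ 2) := by
  refine ⟨12 * Real.exp 1 ^ 5, by positivity, ?_⟩
  intro d N M 𝒳 _ _ ℓ w hw G ε ε' lam r hM hG hε hε' _ hLip hr hrG hlam hlamr x x' xbar hx hx' _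
    hxx hxb i m hm
  have hlog : 0 < Real.log (M : ℝ) := Real.log_pos (by exact_mod_cast (by omega : 1 < M))
  have he : 0 < ε' := by rw [hε']; positivity
  clear hε'
  have hGr : G * r ≤ ε' := by rw [le_div_iff₀ hG] at hrG; linarith
  have hlr : lam * r ≤ G := by rwa [le_div_iff₀ hr] at hlamr
  set B : ℝ := G * ‖x - x'‖ / ε' with hB
  have hB2 : B ≤ 2 := by
    rw [hB, div_le_iff₀ he]; nlinarith [norm_nonneg (x - x')]
  set c : ℝ := lam / 2 * ‖x - xbar‖ ^ 2 / ε' with hc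
  have hc2 : c ≤ 1 / 2 := by
    rw [hc, div_le_iff₀ he]
    have : ‖x - xbar‖ ^ 2 ≤ r ^ 2 := pow_le_pow_left₀ (norm_nonneg _) hxb 2
    nlinarith
  obtain ⟨hp, hp1⟩ := hw i
  set X : Fin N → ℝ := fun j => (ℓ j x - ℓ j x') / ε' with hX
  have hXB : ∀ j, |X j| ≤ B := by
    intro j
    rw [hX, hB]
    simp only [abs_div, abs_of_pos he]
    gcongr
    exact hLip j x hx x' hx'
  have hmR : (0 : ℝ) < m := by exact_mod_cast hm
  set μ : ℝ := ∑ j, w i j * X j with hμ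
  have hμB : |μ| ≤ B := by
    calc |μ| ≤ ∑ j, |w i j * X j| := Finset.abs_sum_le_sum_abs _ _
      _ ≤ ∑ j, w i j * B := by
        apply Finset.sum_le_sum
        intro j _
        rw [abs_mul, abs_of_nonneg (hp j)]
        exact mul_le_mul_of_nonneg_left (hXB j) (hp j)
      _ = B := by rw [← Finset.sum_mul, hp1, one_mul]
  let sg : ℕ → ℝ := fun k => if k < m then 1 else -1
  obtain ⟨-, -, -, h4⟩ := aux_moments (w i) hp hp1 (2 * B) (2 * m)
    (fun k j => sg k * (X j - μ))
    (by
      intro k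
      have : ∑ j, w i j * (sg k * (X j - μ)) = sg k * (∑ j, w i j * X j - (∑ j, w i j) * μ) := by
        rw [Finset.sum_mul, ← Finset.sum_sub_distrib, Finset.mul_sum]
        exact Finset.sum_congr rfl fun j _ => by ring
      rw [this, hp1, ← hμ]; ring)
    (by
      intro k j
      have h1 : |sg k| = 1 := by
        simp only [sg]; split_ifs <;> simp
      rw [abs_mul, h1, one_mul]
      have := abs_sub (X j) μ
      linarith [hXB j])
  have pt : ∀ s : Fin (2 * m) → Fin N,
      (dHat ℓ ε' lam xbar x x' m (extSeq (by omega : 0 < 2 * m) s)) ^ 2 ≤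
      ε' ^ 2 * Real.exp 1 ^ 5 / 64 / m ^ 4 *
        (∑ k : Fin (2 * m), sg k * (X (s k) - μ)) ^ 4 := by
    intro s
    set t := extSeq (by omega : 0 < 2 * m) s with ht
    have hs : ∀ k : Fin (2 * m), s k = t k := by
      intro k; rw [ht]; simp [extSeq]
    set a : ℝ := (m : ℝ)⁻¹ * ∑ k ∈ Finset.range m, X (t k) with ha
    set b : ℝ := (m : ℝ)⁻¹ * ∑ k ∈ Finset.range m, X (t (m + k)) with hb
    have bd : ∀ u : ℕ → Fin N, (m : ℝ)⁻¹ * ∑ k ∈ Finset.range m, X (u k) ≤ 2 := by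
      intro u
      have : ∑ k ∈ Finset.range m, X (u k) ≤ ∑ k ∈ Finset.range m, (2 : ℝ) :=
        Finset.sum_le_sum fun k _ => (le_abs_self _).trans ((hXB _).trans hB2)
      rw [Finset.sum_const, Finset.card_range, nsmul_eq_mul] at this
      rw [inv_mul_le_iff₀ hmR]; exact this
    have hsum : ∑ k : Fin (2 * m), sg k * (X (s k) - μ) = m * (a - b) := by
      simp only [hs]
      rw [Fin.sum_univ_eq_sum_range (fun k => sg k * (X (t k) - μ)) (2 * m), two_mul,
        Finset.sum_range_add]
      have r1 : ∑ k ∈ Finset.range m, sg k * (X (t k) - μ)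
          = ∑ k ∈ Finset.range m, (X (t k) - μ) := by
        refine Finset.sum_congr rfl fun k hk => ?_
        simp [sg, Finset.mem_range.mp hk]
      have r2 : ∑ k ∈ Finset.range m, sg (m + k) * (X (t (m + k)) - μ)
          = ∑ k ∈ Finset.range m, -(X (t (m + k)) - μ) := by
        refine Finset.sum_congr rfl fun k hk => ?_
        simp [sg]
      rw [r1, r2, Finset.sum_neg_distrib, Finset.sum_sub_distrib, Finset.sum_sub_distrib, ha, hb]
      field_simp
      ring
    have g : ∀ (n : ℕ) (u : ℕ → Fin N), gammaHat ℓ ε' lam xbar x x' n u =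
        ε' * Real.exp ((n : ℝ)⁻¹ * ∑ k ∈ Finset.range n, X (u k) + c) := by
      intro n u
      simp only [gammaHat, hX, hc, ← Finset.sum_div]
      congr 2
      ring
    have hab : ((2 * m : ℕ) : ℝ)⁻¹ * ∑ k ∈ Finset.range (2 * m), X (t k) = (a + b) / 2 := by
      rw [two_mul m, Finset.sum_range_add, ha, hb]
      push_cast
      field_simp
      ring
    rw [hsum, dHat, g, g, g, hab]
    refine (aux_point ε' c a b hc2 (bd t) (bd fun k => t (m + k))).trans (le_of_eq ?_)
    field_simp
  calc _ ≤ ∑ s : Fin (2 * m) → Fin N, (∏ k, w i (s k)) * (ε' ^ 2 * Real.exp 1 ^ 5 / 64 / m ^ 4 *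
        (∑ k : Fin (2 * m), sg k * (X (s k) - μ)) ^ 4) :=
        Finset.sum_le_sum fun s _ =>
          mul_le_mul_of_nonneg_left (pt s) (Finset.prod_nonneg fun k _ => hp _)
    _ = ε' ^ 2 * Real.exp 1 ^ 5 / 64 / m ^ 4 * ∑ s : Fin (2 * m) → Fin N, (∏ k, w i (s k)) *
        (∑ k : Fin (2 * m), sg k * (X (s k) - μ)) ^ 4 := by
        rw [Finset.mul_sum]
        exact Finset.sum_congr rfl fun s _ => by ring
    _ ≤ ε' ^ 2 * Real.exp 1 ^ 5 / 64 / m ^ 4 * (3 * ((2 * m : ℕ) : ℝ) ^ 2 * (2 * B) ^ 4) :=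
        mul_le_mul_of_nonneg_left h4 (by positivity)
    _ = _ := by
        rw [hB]
        push_cast
        field_simp
        ring
end
end
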